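/- arXiv:1004.1317 — 2 statements merged into one kernel-verified Lean document; each statement's English description precedes it below -/
import Mathlib

section
/- For every μ ≥ 1, (Real.Gamma (μ²) / Q̄_μ) · ∫_{x ∈ D_μ} (∑_{i ≠ j} p(x) i * p(x) j) · (∏_{i < j} (p(x) i − p(x) j)²) dx = (1 / (μ² (μ² + 1))) · ∑_{k=0}^{μ−1} ∑_{l=0}^{μ−1} ( I_{k k}^{(1)} · I_{l l}^{(1)} − (I_{k l}^{(1)})² ), where the sum on the left is over all ordered pairs (i, j) of distinct indices in Fin μ. -/
open scoped BigOperators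

/-- The Laguerre polynomial `L_n`. -/
noncomputable def laguerre (n : ℕ) (x : ℝ) : ℝ :=
  ∑ k ∈ Finset.range (n + 1), (-1) ^ k * (n.choose k : ℝ) * x ^ k / (k.factorial : ℝ)

/-- `I_{kl}^{(β)} = ∫₀^∞ e^{-q} q^β L_k(q) L_l(q) dq`. -/
noncomputable def Ikl (k l : ℕ) (β : ℝ) : ℝ :=
  ∫ q in Set.Ioi (0 : ℝ), Real.exp (-q) * q ^ β * laguerre k q * laguerre l q

/-- `Q̄_μ = μ! ∏_{k=0}^{μ-1} (k!)²`. -/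
noncomputable def Qbar (μ : ℕ) : ℝ :=
  (μ.factorial : ℝ) * ∏ k ∈ Finset.range μ, ((k.factorial : ℝ)) ^ 2

/-- The simplex domain `D_μ`. -/
def Dset (μ : ℕ) : Set (Fin (μ - 1) → ℝ) :=
  {x | (∀ i, 0 < x i) ∧ ∑ i, x i < 1}

/-- Extension of `x` to the probability simplex in `Fin μ → ℝ`. -/
noncomputable def pExt (μ : ℕ) (x : Fin (μ - 1) → ℝ) : Fin μ → ℝ :=
  fun i => if h : (i : ℕ) < μ - 1 then x ⟨i, h⟩ else 1 - ∑ j, x j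

open MeasureTheory

lemma aux_fwd_zero (m r y : ℕ) :
    (fwdDiff (1:ℕ))^[m + 1 + r] (fun x ↦ (x.choose m : ℤ)) y = 0 := by
  have h0 : (fwdDiff (1:ℕ))^[m] (fun x ↦ (x.choose m : ℤ)) = fun _ => 1 := by
    have := fwdDiff_iter_choose 0 m
    simpa using this
  have h1 : (fwdDiff (1:ℕ))^[m + 1] (fun x ↦ (x.choose m : ℤ)) = fun _ => 0 := by
    rw [Function.iterate_succ_apply', h0]
    funext x
    simp [fwdDiff]
  rw [add_comm, Function.iterate_add_apply, h1]
  rw [fwdDiff_iter_eq_sum_shift]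
  simp

lemma aux_choose_sum (m l : ℕ) (h : m ≤ l) :
    ∑ k ∈ Finset.range (l + 1), (-1 : ℤ) ^ k * l.choose k * (m + k).choose m
      = if m = l then (-1) ^ l else 0 := by
  have key : (-1 : ℤ) ^ l * (fwdDiff (1:ℕ))^[l] (fun x ↦ (x.choose m : ℤ)) m
      = ∑ k ∈ Finset.range (l + 1), (-1 : ℤ) ^ k * l.choose k * (m + k).choose m := by
    rw [fwdDiff_iter_eq_sum_shift, Finset.mul_sum]
    refine Finset.sum_congr rfl fun k hk => ?_
    have hk' : k ≤ l := Nat.lt_succ_iff.mp (Finset.mem_range.mp hk)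
    obtain ⟨d, rfl⟩ := Nat.exists_eq_add_of_le hk'
    have h2 : ((-1 : ℤ) ^ d) * (-1) ^ d = 1 := by
      rw [← mul_pow]; simp
    simp only [Nat.add_sub_cancel_left, smul_eq_mul, mul_one, pow_add]
    linear_combination ((-1 : ℤ) ^ k * (k + d).choose k * (m + k).choose m) * h2
  rw [← key]
  split_ifs with hml
  · subst hml
    have := fwdDiff_iter_choose 0 m
    simp only [add_zero] at this
    rw [this]; simp
  · obtain ⟨r, rfl⟩ := Nat.exists_eq_add_of_lt (lt_of_le_of_ne h hml)
    have := aux_fwd_zero m r m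
    rw [show m + r + 1 = m + 1 + r by ring, this, mul_zero]

lemma aux_int_pow (n : ℕ) : IntegrableOn (fun q : ℝ => Real.exp (-q) * q ^ n) (Set.Ioi 0) := by
  have := Real.GammaIntegral_convergent (s := (n:ℝ) + 1) (by positivity)
  simpa using this

lemma aux_gamma (n : ℕ) :
    ∫ q in Set.Ioi (0:ℝ), Real.exp (-q) * q ^ n = n.factorial := by
  have := Real.Gamma_eq_integral (s := (n:ℝ) + 1) (by positivity)
  rw [Real.Gamma_nat_eq_factorial] at this
  simpa using this.symm

/-- Integrand with natural-number exponent. -/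
noncomputable def lagW (e k l : ℕ) (q : ℝ) : ℝ :=
  Real.exp (-q) * q ^ e * laguerre k q * laguerre l q

noncomputable def lagJ (e k l : ℕ) : ℝ := ∫ q in Set.Ioi (0:ℝ), lagW e k l q

noncomputable def lagc (n k : ℕ) : ℝ := (-1) ^ k * (n.choose k : ℝ) / (k.factorial : ℝ)

lemma laguerre_eq (n : ℕ) (x : ℝ) :
    laguerre n x = ∑ k ∈ Finset.range (n + 1), lagc n k * x ^ k := by
  unfold laguerre lagc
  refine Finset.sum_congr rfl fun k _ => by ring

lemma lagW_eq (e k l : ℕ) (q : ℝ) : lagW e k l q =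
    ∑ a ∈ Finset.range (k + 1), ∑ b ∈ Finset.range (l + 1),
      lagc k a * lagc l b * (Real.exp (-q) * q ^ (e + a + b)) := by
  unfold lagW
  rw [laguerre_eq, laguerre_eq, mul_assoc, Finset.sum_mul_sum, Finset.mul_sum]
  refine Finset.sum_congr rfl fun a _ => ?_
  rw [Finset.mul_sum]
  refine Finset.sum_congr rfl fun b _ => ?_
  ring

lemma lagW_int (e k l : ℕ) : IntegrableOn (lagW e k l) (Set.Ioi 0) := by
  rw [show lagW e k l = fun q => _ from funext (lagW_eq e k l)]
  refine integrable_finsetSum _ fun a _ => integrable_finsetSum _ fun b _ => ?_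
  exact (aux_int_pow _).const_mul _

lemma lagJ_eq (e k l : ℕ) : lagJ e k l =
    ∑ a ∈ Finset.range (k + 1), ∑ b ∈ Finset.range (l + 1),
      lagc k a * lagc l b * ((e + a + b).factorial : ℝ) := by
  unfold lagJ
  simp_rw [lagW_eq]
  rw [integral_finsetSum]
  · refine Finset.sum_congr rfl fun a _ => ?_
    rw [integral_finsetSum]
    · refine Finset.sum_congr rfl fun b _ => ?_
      rw [integral_const_mul, aux_gamma]
    · intro b _
      exact (aux_int_pow _).const_mul _
  · intro a _
    refine integrable_finsetSum _ fun b _ => ?_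
    exact (aux_int_pow _).const_mul _

lemma lagJ_symm (e k l : ℕ) : lagJ e k l = lagJ e l k := by
  unfold lagJ lagW
  congr 1; funext q; ring

lemma Ikl_eq (k l : ℕ) : Ikl k l 1 = lagJ 1 k l := by
  unfold Ikl lagJ lagW
  simp

lemma lagJ_zero_le (k l : ℕ) (h : k ≤ l) : lagJ 0 k l = if k = l then 1 else 0 := by
  rw [lagJ_eq]
  have inner : ∀ a ∈ Finset.range (k + 1), (∑ b ∈ Finset.range (l + 1),
      lagc k a * lagc l b * ((0 + a + b).factorial : ℝ))
      = (-1) ^ a * (k.choose a : ℝ) * (if a = l then (-1) ^ l else 0) := by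
    intro a ha
    have ha' : a ≤ l := (Nat.lt_succ_iff.mp (Finset.mem_range.mp ha)).trans h
    have hc := aux_choose_sum a l ha'
    have hc' : ∑ b ∈ Finset.range (l + 1), (-1 : ℝ) ^ b * l.choose b * (a + b).choose a
      = if a = l then (-1) ^ l else 0 := by exact_mod_cast hc
    rw [← hc', Finset.mul_sum]
    refine Finset.sum_congr rfl fun b _ => ?_
    have hf : ((a + b).choose a : ℝ) * a.factorial * b.factorial = (a + b).factorial := by
      have := Nat.add_choose_mul_factorial_mul_factorial a b
      rw [← Nat.choose_symm_add] at this
      exact_mod_cast this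
    unfold lagc
    rw [zero_add, ← hf]
    have h1 : (a.factorial : ℝ) ≠ 0 := by positivity
    have h2 : (b.factorial : ℝ) ≠ 0 := by positivity
    field_simp
  rw [Finset.sum_congr rfl inner]
  simp only [mul_ite, mul_zero, Finset.sum_ite_eq', Finset.mem_range]
  by_cases hkl : k = l
  · subst hkl
    simp [← mul_pow]
  · rw [if_neg hkl, if_neg (by omega)]

lemma lagJ_zero (k l : ℕ) : lagJ 0 k l = if k = l then 1 else 0 := by
  rcases le_total k l with h | h
  · exact lagJ_zero_le k l h
  · rw [lagJ_symm, lagJ_zero_le l k h]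
    simp [eq_comm]
lemma lagc_zero {n k : ℕ} (h : n < k) : lagc n k = 0 := by
  simp [lagc, Nat.choose_eq_zero_of_lt h]

lemma laguerre_fin (n : ℕ) (j : Fin n) (x : ℝ) :
    laguerre j x = ∑ k : Fin n, x ^ (k : ℕ) * lagc j k := by
  rw [Fin.sum_univ_eq_sum_range (fun k => x ^ k * lagc j k), laguerre_eq]
  have : Finset.range ((j : ℕ) + 1) ⊆ Finset.range n := by
    intro k hk; have := j.2; simp at hk ⊢; omega
  rw [← Finset.sum_subset this]
  · exact Finset.sum_congr rfl fun k _ => mul_comm _ _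
  · intro k _ hk
    rw [lagc_zero (by simpa using hk), mul_zero]

lemma vand_sq (n : ℕ) (q : Fin n → ℝ) :
    (∏ i, ∏ j ∈ Finset.Ioi i, (q i - q j) ^ 2) =
      (∏ k ∈ Finset.range n, ((k.factorial : ℝ)) ^ 2) *
        (Matrix.of (fun i j : Fin n => laguerre j (q i))).det ^ 2 := by
  have h1 : Matrix.of (fun i j : Fin n => laguerre j (q i)) =
      Matrix.vandermonde q * Matrix.of (fun k j : Fin n => lagc j k) := by
    ext i j
    simp [Matrix.mul_apply, Matrix.vandermonde_apply, laguerre_fin n j]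
  have h2 : (Matrix.of (fun k j : Fin n => lagc j k)).det = ∏ j : Fin n, lagc j j := by
    rw [Matrix.det_of_isUpperTriangular]
    · simp
    · intro i j hij
      exact lagc_zero hij
  rw [h1, Matrix.det_mul, h2, Matrix.det_vandermonde,
    ← Fin.prod_univ_eq_prod_range (fun k => ((k.factorial : ℝ)) ^ 2), mul_pow, mul_comm,
    ← Finset.prod_pow, ← Finset.prod_pow, mul_assoc, ← Finset.prod_mul_distrib]
  rw [Finset.prod_congr rfl (g := fun _ => (1:ℝ)) (s₁ := Finset.univ) (s₂ := Finset.univ)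
    (f := fun i : Fin n => lagc i i ^ 2 * (i.val.factorial : ℝ) ^ 2)]
  · simp only [Finset.prod_const_one, mul_one, ← Finset.prod_pow]
    refine Finset.prod_congr rfl fun i _ => Finset.prod_congr rfl fun j _ => by ring
  · intro i _
    have : (i.val.factorial : ℝ) ≠ 0 := by positivity
    unfold lagc
    field_simp
    simp [← pow_mul]

/-- exponent weight -/
def wt {n : ℕ} (i j m : Fin n) : ℕ := if m = i ∨ m = j then 1 else 0

lemma wt_prod {n : ℕ} (i j : Fin n) (h : i ≠ j) (q : Fin n → ℝ) :
    ∏ m, q m ^ wt i j m = q i * q j := by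
  rw [← Finset.prod_pair h, ← Finset.prod_subset (Finset.subset_univ {i, j})]
  · refine Finset.prod_congr rfl fun m hm => ?_
    simp at hm
    simp [wt, hm]
  · intro m _ hm
    simp at hm
    simp [wt, hm]

lemma expand {n : ℕ} (i j : Fin n) (h : i ≠ j) (q : Fin n → ℝ) :
    Real.exp (-∑ m, q m) * (q i * q j *
        (Matrix.of (fun i j : Fin n => laguerre j (q i))).det ^ 2) =
      ∑ σ : Equiv.Perm (Fin n), ∑ τ : Equiv.Perm (Fin n),
        ((Equiv.Perm.sign σ : ℤ) : ℝ) * ((Equiv.Perm.sign τ : ℤ) : ℝ) *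
          ∏ m, lagW (wt i j m) (σ m) (τ m) (q m) := by
  have hd : (Matrix.of (fun i j : Fin n => laguerre j (q i))).det =
      ∑ σ : Equiv.Perm (Fin n), ((Equiv.Perm.sign σ : ℤ) : ℝ) * ∏ m, laguerre (σ m) (q m) := by
    rw [← Matrix.det_transpose, Matrix.det_apply']
    rfl
  rw [hd, sq, Finset.sum_mul_sum, ← wt_prod i j h q, ← mul_assoc, Finset.mul_sum,
    ← Finset.sum_neg_distrib, Real.exp_sum]
  refine Finset.sum_congr rfl fun σ _ => ?_
  rw [Finset.mul_sum]
  refine Finset.sum_congr rfl fun τ _ => ?_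
  simp only [lagW, Finset.prod_mul_distrib]
  ring

/-- the measure on the positive orthant -/
noncomputable def orth (n : ℕ) : Measure (Fin n → ℝ) :=
  Measure.pi fun _ => volume.restrict (Set.Ioi (0:ℝ))

lemma orth_eq (n : ℕ) : orth n = volume.restrict {q : Fin n → ℝ | ∀ i, 0 < q i} := by
  unfold orth
  rw [← Measure.restrict_pi_pi, volume_pi]
  congr 1
  ext q; simp

lemma term_int {n : ℕ} (i j : Fin n) (σ τ : Equiv.Perm (Fin n)) :
    Integrable (fun q : Fin n → ℝ => ∏ m, lagW (wt i j m) (σ m) (τ m) (q m)) (orth n) :=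
  Integrable.fintype_prod (f := fun (m : Fin n) => lagW (wt i j m) (σ m) (τ m))
    fun m => lagW_int _ _ _

lemma pair_int {n : ℕ} (i j : Fin n) (h : i ≠ j) :
    Integrable (fun q : Fin n → ℝ => Real.exp (-∑ m, q m) * (q i * q j *
        (Matrix.of (fun i j : Fin n => laguerre j (q i))).det ^ 2)) (orth n) := by
  simp_rw [expand i j h]
  refine integrable_finsetSum _ fun σ _ => integrable_finsetSum _ fun τ _ => ?_
  exact (term_int i j σ τ).const_mul _

lemma perm_cases {n : ℕ} (i j : Fin n) (ρ : Equiv.Perm (Fin n))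
    (h : ∀ m, m ≠ i → m ≠ j → ρ m = m) : ρ = 1 ∨ ρ = Equiv.swap i j := by
  have hi : ρ i = i ∨ ρ i = j := by
    by_contra hc
    push Not at hc
    exact hc.1 (ρ.injective (h _ hc.1 hc.2))
  have hj : ρ j = i ∨ ρ j = j := by
    by_contra hc
    push Not at hc
    exact hc.2 (ρ.injective (h _ hc.1 hc.2))
  have inj := ρ.injective.eq_iff (a := i) (b := j)
  rcases hi with hi | hi
  · left
    ext m
    by_cases h1 : m = i
    · simp [h1, hi]
    by_cases h2 : m = j
    · subst h2; rcases hj with hj | hj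
      · exact absurd (ρ.injective (hj.trans hi.symm)) h1
      · simp [hj]
    · simp [h m h1 h2]
  · right
    have hj' : ρ j = i := by
      rcases hj with hj | hj
      · exact hj
      · have : i = j := ρ.injective (hi.trans hj.symm)
        rw [hj, this]
    ext m
    by_cases h1 : m = i
    · simp [h1, hi]
    by_cases h2 : m = j
    · simp [h2, hj']
    · simp [h m h1 h2, Equiv.swap_apply_of_ne_of_ne h1 h2]

lemma lag_inner_sum {n : ℕ} (i j : Fin n) (h : i ≠ j) (σ : Equiv.Perm (Fin n)) :
    ∑ τ : Equiv.Perm (Fin n),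
        ((Equiv.Perm.sign σ : ℤ) : ℝ) * ((Equiv.Perm.sign τ : ℤ) : ℝ) *
          ∏ m, lagJ (wt i j m) (σ m) (τ m) =
    lagJ 1 (σ i) (σ i) * lagJ 1 (σ j) (σ j) - lagJ 1 (σ i) (σ j) ^ 2 := by
  rw [← Equiv.sum_comp (Equiv.mulLeft σ)]
  have hs : ((Equiv.Perm.sign σ : ℤ) : ℝ) * ((Equiv.Perm.sign σ : ℤ) : ℝ) = 1 := by
    rw [← Int.cast_mul, ← Units.val_mul]; simp
  have hprod : ∀ f : Fin n → ℝ, (∀ m, m ≠ i → m ≠ j → f m = 1) → ∏ m, f m = f i * f j := by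
    intro f hf
    rw [← Finset.prod_pair h, ← Finset.prod_subset (Finset.subset_univ {i, j})]
    intro m _ hm
    simp at hm
    exact hf m hm.1 hm.2
  have h1s : (1 : Equiv.Perm (Fin n)) ≠ Equiv.swap i j := by
    intro hc
    have := congrArg (fun e => e i) hc
    simp at this
    exact h this
  rw [← Finset.sum_subset (Finset.subset_univ {1, Equiv.swap i j})]
  · rw [Finset.sum_pair h1s]
    rw [hprod, hprod]
    · simp only [Equiv.coe_mulLeft, mul_one, Equiv.Perm.sign_mul, Equiv.Perm.sign_swap h,
        Equiv.Perm.mul_apply, Equiv.swap_apply_left, Equiv.swap_apply_right, wt]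
      simp only [true_or, or_true, if_true, lagJ_symm 1 (σ j) (σ i)]
      push_cast
      linear_combination (lagJ 1 (σ i) (σ i) * lagJ 1 (σ j) (σ j) - lagJ 1 (σ i) (σ j) ^ 2) * hs
    · intro m h1 h2
      simp [wt, h1, h2, lagJ_zero, Equiv.swap_apply_of_ne_of_ne h1 h2]
    · intro m h1 h2
      simp [wt, h1, h2, lagJ_zero]
  · intro ρ _ hρ
    have : ∃ m, m ≠ i ∧ m ≠ j ∧ ρ m ≠ m := by
      by_contra hc
      push Not at hc
      have := perm_cases i j ρ hc
      simp at hρ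
      tauto
    obtain ⟨m, h1, h2, h3⟩ := this
    rw [Finset.prod_eq_zero (Finset.mem_univ m), mul_zero]
    simp only [wt, h1, h2, or_self, if_false, lagJ_zero, Equiv.coe_mulLeft,
      Equiv.Perm.mul_apply]
    rw [if_neg]
    intro hc
    exact h3 (σ.injective (Fin.ext hc)).symm

lemma pair_integral {n : ℕ} (i j : Fin n) (h : i ≠ j) :
    ∫ q, Real.exp (-∑ m, q m) * (q i * q j *
        (Matrix.of (fun i j : Fin n => laguerre j (q i))).det ^ 2) ∂(orth n) =
    ∑ σ : Equiv.Perm (Fin n),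
      (lagJ 1 (σ i) (σ i) * lagJ 1 (σ j) (σ j) - lagJ 1 (σ i) (σ j) ^ 2) := by
  simp_rw [expand i j h]
  rw [integral_finsetSum]
  · refine Finset.sum_congr rfl fun σ _ => ?_
    rw [integral_finsetSum, ← lag_inner_sum i j h σ]
    · refine Finset.sum_congr rfl fun τ _ => ?_
      rw [integral_const_mul]
      congr 1
      exact integral_fintype_prod_eq_prod (fun (m : Fin n) => lagW (wt i j m) (σ m) (τ m))
    · intro τ _
      exact (term_int i j σ τ).const_mul _
  · intro σ _
    refine integrable_finsetSum _ fun τ _ => ?_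
    exact (term_int i j σ τ).const_mul _

noncomputable def Ffun (n : ℕ) (q : Fin n → ℝ) : ℝ :=
  (∑ ij ∈ Finset.univ.filter (fun ij : Fin n × Fin n => ij.1 ≠ ij.2), q ij.1 * q ij.2) *
    (∏ i, ∏ j ∈ Finset.Ioi i, (q i - q j) ^ 2)

lemma F_eq (n : ℕ) (q : Fin n → ℝ) : Real.exp (-∑ m, q m) * Ffun n q =
    (∏ k ∈ Finset.range n, ((k.factorial : ℝ)) ^ 2) *
    ∑ ij ∈ Finset.univ.filter (fun ij : Fin n × Fin n => ij.1 ≠ ij.2),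
      Real.exp (-∑ m, q m) * (q ij.1 * q ij.2 *
        (Matrix.of (fun i j : Fin n => laguerre j (q i))).det ^ 2) := by
  unfold Ffun
  rw [vand_sq, ← Finset.mul_sum, ← Finset.sum_mul]
  ring

lemma F_int (n : ℕ) :
    Integrable (fun q : Fin n → ℝ => Real.exp (-∑ m, q m) * Ffun n q) (orth n) := by
  simp_rw [F_eq]
  refine Integrable.const_mul (integrable_finsetSum _ fun ij hij => ?_) _
  exact pair_int _ _ (by simpa using hij)

lemma F_integral (n : ℕ) :
    ∫ q : Fin n → ℝ, Real.exp (-∑ m, q m) * Ffun n q ∂(orth n) =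
    Qbar n * ∑ k ∈ Finset.range n, ∑ l ∈ Finset.range n,
          (Ikl k k 1 * Ikl l l 1 - (Ikl k l 1) ^ 2) := by
  simp_rw [F_eq]
  rw [integral_const_mul, integral_finsetSum]
  · rw [Finset.sum_congr rfl fun (ij : Fin n × Fin n) hij =>
      pair_integral ij.1 ij.2 (by simpa using hij)]
    rw [Finset.sum_comm]
    have key : ∀ σ : Equiv.Perm (Fin n),
        ∑ ij ∈ Finset.univ.filter (fun ij : Fin n × Fin n => ij.1 ≠ ij.2),
          (lagJ 1 (σ ij.1) (σ ij.1) * lagJ 1 (σ ij.2) (σ ij.2) - lagJ 1 (σ ij.1) (σ ij.2) ^ 2)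
        = ∑ k ∈ Finset.range n, ∑ l ∈ Finset.range n,
          (Ikl k k 1 * Ikl l l 1 - (Ikl k l 1) ^ 2) := by
      intro σ
      rw [Finset.sum_subset (Finset.subset_univ _)]
      · rw [Fintype.sum_prod_type]
        simp_rw [Ikl_eq]
        rw [Finset.sum_range]
        simp_rw [Finset.sum_range]
        refine Eq.trans ?_ (Equiv.sum_comp σ (fun i : Fin n => ∑ j : Fin n,
          (lagJ 1 i i * lagJ 1 j j - lagJ 1 i j ^ 2)))
        refine Finset.sum_congr rfl fun i _ => ?_
        exact Equiv.sum_comp σ (fun j : Fin n => lagJ 1 (σ i) (σ i) * lagJ 1 j j - lagJ 1 (σ i) j ^ 2)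
      · intro ij _ hij
        have : ij.1 = ij.2 := by simpa using hij
        rw [this]; ring
    rw [Finset.sum_congr rfl fun σ _ => key σ]
    simp only [Finset.sum_const, Finset.card_univ, Fintype.card_perm, Fintype.card_fin,
      nsmul_eq_mul, Qbar]
    ring
  · intro ij hij
    exact pair_int _ _ (by simpa using hij)
/-- shear map -/
noncomputable def shear (m : ℕ) (z : (Fin m → ℝ) × ℝ) : Fin (m + 1) → ℝ :=
  Fin.snoc (α := fun _ => ℝ) z.1 (z.2 - ∑ i, z.1 i)

lemma shear_mp (m : ℕ) : MeasurePreserving (shear m)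
    ((volume : Measure (Fin m → ℝ)).prod (volume : Measure ℝ)) volume := by
  have h1 : MeasurePreserving (fun z : (Fin m → ℝ) × ℝ => (id z.1, z.2 - ∑ i, z.1 i))
      ((volume : Measure (Fin m → ℝ)).prod (volume : Measure ℝ))
      ((volume : Measure (Fin m → ℝ)).prod (volume : Measure ℝ)) := by
    refine (MeasurePreserving.id _).skew_product (g := fun (y : Fin m → ℝ) (t : ℝ) => t - ∑ i, y i) ?_ ?_
    · unfold Function.uncurry
      fun_prop
    · refine Filter.Eventually.of_forall fun y => ?_
      exact (measurePreserving_sub_right volume _).map_eq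
  have h2 := Measure.measurePreserving_swap (μ := (volume : Measure (Fin m → ℝ)))
    (ν := (volume : Measure ℝ))
  have h3 := (volume_preserving_piFinSuccAbove (fun _ : Fin (m + 1) => ℝ) (Fin.last m)).symm
  have h4 := h3.comp (h2.comp h1)
  suffices h5 : shear m = (⇑(MeasurableEquiv.piFinSuccAbove (fun _ : Fin (m + 1) => ℝ)
      (Fin.last m)).symm ∘ Prod.swap ∘
      fun z : (Fin m → ℝ) × ℝ => (id z.1, z.2 - ∑ i, z.1 i)) by
    rw [h5]; exact h4
  funext z
  simp only [shear, Function.comp, id, Prod.swap]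
  exact (Fin.insertNth_last' (β := ℝ) _ _).symm

lemma shear_sum (m : ℕ) (z : (Fin m → ℝ) × ℝ) : ∑ i, shear m z i = z.2 := by
  simp [shear, Fin.sum_univ_castSucc]

lemma shear_pos (m : ℕ) (z : (Fin m → ℝ) × ℝ) :
    (∀ i, 0 < shear m z i) ↔ (∀ i, 0 < z.1 i) ∧ ∑ i, z.1 i < z.2 := by
  simp [shear, Fin.forall_fin_succ']

lemma shear_smul (m : ℕ) (s : ℝ) (y : Fin m → ℝ) : shear m (s • y, s) = s • shear m (y, 1) := by
  funext i
  refine Fin.lastCases ?_ (fun i => ?_) i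
  · simp [shear, mul_sub, Finset.mul_sum]
  · simp [shear]

lemma shear_pExt (m : ℕ) (x : Fin m → ℝ) : pExt (m + 1) x = shear m (x, 1) := by
  funext i
  refine Fin.lastCases ?_ (fun i => ?_) i
  · simp [shear, pExt]
  · simp [shear, pExt]

lemma polar (m d : ℕ) (F : (Fin (m + 1) → ℝ) → ℝ)
    (hF : ∀ s : ℝ, 0 < s → ∀ p, F (s • p) = s ^ d * F p)
    (hint : Integrable (fun q => Real.exp (-∑ i, q i) * F q) (orth (m + 1))) :
    ∫ q, Real.exp (-∑ i, q i) * F q ∂(orth (m + 1)) =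
      ((m + d).factorial : ℝ) * ∫ x in Dset (m + 1), F (pExt (m + 1) x) := by
  set S : Set (Fin (m + 1) → ℝ) := {q | ∀ i, 0 < q i} with hS
  have hSm : MeasurableSet S := by
    have : S = ⋂ i, {q | 0 < q i} := by ext; simp [hS]
    rw [this]
    exact MeasurableSet.iInter fun i => measurableSet_lt measurable_const (measurable_pi_apply i)
  rw [orth_eq] at hint ⊢
  set G : (Fin (m + 1) → ℝ) → ℝ := S.indicator (fun q => Real.exp (-∑ i, q i) * F q) with hG
  have hGi : Integrable G volume := (integrable_indicator_iff hSm).2 hint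
  rw [← integral_indicator hSm]
  change ∫ q, G q = _
  have hmp := shear_mp m
  have hGi' : Integrable (fun z => G (shear m z))
      ((volume : Measure (Fin m → ℝ)).prod (volume : Measure ℝ)) :=
    hmp.integrable_comp_of_integrable hGi
  have e1 : ∫ q, G q = ∫ z, G (shear m z)
      ∂((volume : Measure (Fin m → ℝ)).prod (volume : Measure ℝ)) := by
    rw [← hmp.map_eq, integral_map hmp.measurable.aemeasurable]
    rw [hmp.map_eq]
    exact hGi.aestronglyMeasurable
  rw [e1, integral_prod_symm _ hGi']
  set C : ℝ := ∫ x in Dset (m + 1), F (pExt (m + 1) x) with hC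
  have hDm : MeasurableSet (Dset (m + 1)) := by
    have : Dset (m + 1) = (⋂ i, {q | 0 < q i}) ∩ {q | ∑ i, q i < 1} := by
      ext; simp [Dset]
    rw [this]
    refine (MeasurableSet.iInter fun i =>
      measurableSet_lt measurable_const (measurable_pi_apply i)).inter ?_
    exact measurableSet_lt (by fun_prop) measurable_const
  have hin : ∀ s : ℝ, ∫ y, G (shear m (y, s)) =
      (Set.Ioi (0:ℝ)).indicator (fun s => C * (Real.exp (-s) * s ^ (m + d))) s := by
    intro s
    by_cases hs : 0 < s
    · rw [Set.indicator_of_mem (by exact hs)]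
      have hsc := Measure.integral_comp_smul_of_nonneg (volume : Measure (Fin m → ℝ))
        (fun y => G (shear m (y, s))) s (hR := hs.le)
      have hpt : ∀ x : Fin m → ℝ, G (shear m (s • x, s)) =
          Real.exp (-s) * s ^ d * (Dset (m + 1)).indicator (fun x => F (pExt (m + 1) x)) x := by
        intro x
        have hiff : shear m (s • x, s) ∈ S ↔ x ∈ Dset (m + 1) := by
          change (∀ i, 0 < shear m (s • x, s) i) ↔ ((∀ i, 0 < x i) ∧ ∑ i, x i < 1)
          rw [shear_pos]
          simp only [Pi.smul_apply, smul_eq_mul, ← Finset.mul_sum, mul_pos_iff_of_pos_left hs]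
          rw [mul_lt_iff_lt_one_right hs]
        by_cases hx : x ∈ Dset (m + 1)
        · rw [Set.indicator_of_mem hx, hG, Set.indicator_of_mem (hiff.2 hx), shear_sum,
            shear_smul, hF s hs, shear_pExt]
          ring
        · rw [Set.indicator_of_notMem hx, hG, Set.indicator_of_notMem (fun h => hx (hiff.1 h))]
          simp
      simp_rw [hpt] at hsc
      rw [integral_const_mul] at hsc
      have hCi : ∫ x : Fin m → ℝ, (Dset (m + 1)).indicator (fun x => F (pExt (m + 1) x)) x = C :=
        integral_indicator hDm
      rw [hCi] at hsc
      simp only [Module.finrank_fin_fun, smul_eq_mul] at hsc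
      have hsp : s ^ m ≠ 0 := (pow_pos hs m).ne'
      field_simp at hsc
      rw [← hsc]
      ring
    · rw [Set.indicator_of_notMem (by exact hs)]
      have : ∀ y, G (shear m (y, s)) = 0 := by
        intro y
        refine Set.indicator_of_notMem (fun h => hs ?_) _
        have h' := (shear_pos m (y, s)).1 h
        exact lt_of_le_of_lt (Finset.sum_nonneg fun i _ => (h'.1 i).le) h'.2
      simp [this]
  simp_rw [hin]
  rw [integral_indicator measurableSet_Ioi, integral_const_mul, aux_gamma, mul_comm]

lemma sum_card (n : ℕ) : ∑ i : Fin n, (Finset.Ioi i).card * 2 = n * (n - 1) := by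
  simp_rw [Fin.card_Ioi]
  rw [← Finset.sum_mul, Fin.sum_univ_eq_sum_range (fun i => n - 1 - i),
    Finset.sum_range_reflect (fun i => i) n, Finset.sum_range_id_mul_two]

lemma F_hom (n : ℕ) (s : ℝ) (p : Fin n → ℝ) :
    Ffun n (s • p) = s ^ (2 + n * (n - 1)) * Ffun n p := by
  unfold Ffun
  have h1 : ∀ i j : Fin n, ((s • p) i - (s • p) j) ^ 2 = s ^ 2 * (p i - p j) ^ 2 := by
    intro i j; simp; ring
  have h2 : ∀ i j : Fin n, (s • p) i * (s • p) j = s ^ 2 * (p i * p j) := by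
    intro i j; simp; ring
  simp_rw [h1, h2, Finset.prod_mul_distrib, Finset.prod_const, ← Finset.mul_sum, ← pow_mul]
  rw [Finset.prod_pow_eq_pow_sum, ← sum_card n, pow_add]
  simp_rw [mul_comm 2]
  ring

lemma Qbar_ne (n : ℕ) : Qbar n ≠ 0 := by
  unfold Qbar
  have : ∏ k ∈ Finset.range n, ((k.factorial : ℝ)) ^ 2 ≠ 0 :=
    Finset.prod_ne_zero_iff.2 fun k _ => by positivity
  positivity

theorem second_moment_pairs_formula (μ : ℕ) (hμ : 1 ≤ μ) :
    (Real.Gamma ((μ : ℝ) ^ 2) / Qbar μ) *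
      ∫ x in Dset μ,
        (∑ ij ∈ Finset.univ.filter (fun ij : Fin μ × Fin μ => ij.1 ≠ ij.2),
            pExt μ x ij.1 * pExt μ x ij.2) *
          (∏ i, ∏ j ∈ Finset.Ioi i, (pExt μ x i - pExt μ x j) ^ 2)
      = (1 / ((μ : ℝ) ^ 2 * ((μ : ℝ) ^ 2 + 1))) *
        ∑ k ∈ Finset.range μ, ∑ l ∈ Finset.range μ,
          (Ikl k k 1 * Ikl l l 1 - (Ikl k l 1) ^ 2) := by
  obtain ⟨m, rfl⟩ : ∃ m, μ = m + 1 := ⟨μ - 1, by omega⟩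
  have h1 := polar m (2 + (m + 1) * (m + 1 - 1)) (Ffun (m + 1))
    (fun s _ p => F_hom (m + 1) s p) (F_int (m + 1))
  rw [F_integral] at h1
  have hN : m + (2 + (m + 1) * (m + 1 - 1)) = (m + 1) ^ 2 + 1 := by
    simp only [Nat.add_sub_cancel]; ring
  rw [hN] at h1
  have hpos : (0:ℝ) < ((m + 1 : ℕ) : ℝ) ^ 2 := by positivity
  have hG : (((m + 1) ^ 2 + 1).factorial : ℝ) =
      (((m + 1 : ℕ) : ℝ) ^ 2 + 1) * (((m + 1 : ℕ) : ℝ) ^ 2 * Real.Gamma (((m + 1 : ℕ) : ℝ) ^ 2)) := by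
    rw [← Real.Gamma_add_one hpos.ne', ← Real.Gamma_add_one (by positivity),
      ← Real.Gamma_nat_eq_factorial]
    push_cast
    rfl
  change Real.Gamma (((m + 1 : ℕ) : ℝ) ^ 2) / Qbar (m + 1) *
    ∫ x in Dset (m + 1), Ffun (m + 1) (pExt (m + 1) x) = _
  rw [hG] at h1
  have hQ := Qbar_ne (m + 1)
  have hpos' : ((m + 1 : ℕ) : ℝ) ^ 2 ≠ 0 := hpos.ne'
  have hpos2 : ((m + 1 : ℕ) : ℝ) ^ 2 + 1 ≠ 0 := by positivity
  generalize ((m + 1 : ℕ) : ℝ) ^ 2 = N at *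
  rw [div_mul_eq_mul_div, div_eq_iff hQ, one_div, inv_mul_eq_div, div_mul_eq_mul_div,
    eq_div_iff (mul_ne_zero hpos' hpos2)]
  linear_combination -h1
end

section
/- For every μ ≥ 1, (Real.Gamma (μ²) / Q̄_μ) · ∫_{x ∈ D_μ} (∑_{i, j, k pairwise distinct} p(x) i · Real.sqrt (p(x) j * p(x) k)) · (∏_{a < b} (p(x) a − p(x) b)²) dx = (1 / (μ² (μ² + 1))) · ∑_{k=0}^{μ−1} ∑_{l=0}^{μ−1} ∑_{m=0}^{μ−1} det [[I_{k k}^{(1)}, I_{k l}^{(1/2)}, I_{k m}^{(1/2)}], [I_{l k}^{(1)}, I_{l l}^{(1/2)}, I_{l m}^{(1/2)}], [I_{m k}^{(1)}, I_{m l}^{(1/2)}, I_{m m}^{(1/2)}]], where the sum on the left is over all ordered triples of pairwise distinct indices in Fin μ. -/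
open scoped BigOperators

theorem tmf_det3 {N : Type*} [Fintype N] [DecidableEq N] (M : Matrix N N ℝ) (e : Fin 3 → N)
    (he : Function.Injective e) (hM : ∀ a, a ∉ Set.range e → ∀ b, M a b = if a = b then 1 else 0) :
    M.det = (M.submatrix e e).det := by
  classical
  have h := Matrix.twoBlockTriangular_det M (fun a => a ∈ Set.range e) (by
    intro i hi j hj
    rw [hM i hi, if_neg]
    rintro rfl; exact hi hj)
  rw [h]
  have h2 : (M.toSquareBlockProp fun a => ¬ a ∈ Set.range e) = 1 := by
    ext ⟨i, hi⟩ ⟨j, hj⟩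
    simp [Matrix.toSquareBlockProp_def, hM i hi, Matrix.one_apply]
  rw [h2, Matrix.det_one, mul_one]
  let E : Fin 3 ≃ {a // a ∈ Set.range e} := Equiv.ofInjective e he
  exact (@Matrix.det_submatrix_equiv_self _ _ _ _ _ (Subtype.fintype fun a => a ∈ Set.range e) _ _ E (M.toSquareBlockProp fun a => a ∈ Set.range e)).symm

theorem tmf_comb (μ : ℕ) (J : ℕ → ℕ → ℝ → ℝ) (horth : ∀ k l, J k l 0 = if k = l then 1 else 0)
    (hsym : ∀ k l b, J k l b = J l k b)
    (β : Fin μ × Fin μ × Fin μ → Fin μ → ℝ)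
    (hβ : ∀ t a, β t a = (if a = t.1 then 1 else 0) + (if a = t.2.1 then 1/2 else 0)
      + (if a = t.2.2 then 1/2 else 0)) :
    ∑ t ∈ Finset.univ.filter
            (fun t : Fin μ × Fin μ × Fin μ =>
              t.1 ≠ t.2.1 ∧ t.1 ≠ t.2.2 ∧ t.2.1 ≠ t.2.2),
      ∑ σ : Equiv.Perm (Fin μ), ∑ τ : Equiv.Perm (Fin μ),
        ((Equiv.Perm.sign σ : ℤ) : ℝ) * ((Equiv.Perm.sign τ : ℤ) : ℝ) *
          ∏ a, J (σ a) (τ a) (β t a) =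
    (μ.factorial : ℝ) * ∑ k ∈ Finset.range μ, ∑ l ∈ Finset.range μ, ∑ m ∈ Finset.range μ,
          Matrix.det !![J k k 1, J k l (1/2), J k m (1/2);
                        J l k 1, J l l (1/2), J l m (1/2);
                        J m k 1, J m l (1/2), J m m (1/2)] := by
  classical
  set D : ℕ → ℕ → ℕ → ℝ := fun k l m => Matrix.det !![J k k 1, J k l (1/2), J k m (1/2);
                        J l k 1, J l l (1/2), J l m (1/2);
                        J m k 1, J m l (1/2), J m m (1/2)] with hD
  have hrhs : ∑ k ∈ Finset.range μ, ∑ l ∈ Finset.range μ, ∑ m ∈ Finset.range μ, D k l m =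
      ∑ t ∈ Finset.univ.filter
            (fun t : Fin μ × Fin μ × Fin μ =>
              t.1 ≠ t.2.1 ∧ t.1 ≠ t.2.2 ∧ t.2.1 ≠ t.2.2), D t.1 t.2.1 t.2.2 := by
    simp only [Finset.sum_range]
    rw [Finset.sum_filter_of_ne, Fintype.sum_prod_type]
    · refine Finset.sum_congr rfl fun k _ => ?_
      rw [Fintype.sum_prod_type]
    · rintro ⟨k, l, m⟩ - h
      refine ⟨?_, ?_, ?_⟩ <;> (rintro h'; apply h; simp only at h'; subst h'; simp only [hD, Matrix.det_fin_three]; simp; try ring)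
  have hin : ∀ t : Fin μ × Fin μ × Fin μ, t.1 ≠ t.2.1 ∧ t.1 ≠ t.2.2 ∧ t.2.1 ≠ t.2.2 →
      ∀ σ : Equiv.Perm (Fin μ), ∑ τ : Equiv.Perm (Fin μ),
        ((Equiv.Perm.sign σ : ℤ) : ℝ) * ((Equiv.Perm.sign τ : ℤ) : ℝ) *
          ∏ a, J (σ a) (τ a) (β t a) = D (σ t.1) (σ t.2.1) (σ t.2.2) := by
    rintro ⟨i, j, k⟩ ⟨hij, hik, hjk⟩ σ
    simp only at hij hik hjk ⊢
    have e1 : ∑ τ : Equiv.Perm (Fin μ),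
        ((Equiv.Perm.sign σ : ℤ) : ℝ) * ((Equiv.Perm.sign τ : ℤ) : ℝ) *
          ∏ a, J (σ a) (τ a) (β (i,j,k) a) =
        (Matrix.of fun a b : Fin μ => J (σ a) (σ b) (β (i,j,k) a)).det := by
      rw [← Matrix.det_transpose, Matrix.det_apply', ← Equiv.sum_comp (Equiv.mulLeft σ)]
      refine Finset.sum_congr rfl fun π _ => ?_
      simp only [Equiv.coe_mulLeft, Equiv.Perm.sign_mul, Equiv.Perm.mul_apply,
        Matrix.transpose_apply, Matrix.of_apply]
      congr 1
      push_cast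
      rw [← mul_assoc, ← Int.cast_mul, ← Units.val_mul, Int.units_mul_self]
      simp
    have inj : Function.Injective ![i, j, k] := by
      intro a b
      fin_cases a <;> fin_cases b <;> simp [hij, hik, hjk, hij.symm, hik.symm, hjk.symm]
    have b1 : β (i,j,k) i = 1 := by rw [hβ]; simp [hij, hik]
    have b2 : β (i,j,k) j = 1/2 := by rw [hβ]; simp [hij.symm, hjk]
    have b3 : β (i,j,k) k = 1/2 := by rw [hβ]; simp [hik.symm, hjk.symm]
    rw [e1, tmf_det3 _ ![i,j,k] inj, ← Matrix.det_transpose]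
    · simp only [hD]
      congr 1
      ext a b
      fin_cases a <;> fin_cases b <;> simp [b1, b2, b3] <;> exact hsym _ _ _
    · intro a ha b
      have : β (i,j,k) a = 0 := by
        rw [hβ]
        have h0 : a ≠ i := by rintro rfl; exact ha ⟨0, rfl⟩
        have h1 : a ≠ j := by rintro rfl; exact ha ⟨1, rfl⟩
        have h2 : a ≠ k := by rintro rfl; exact ha ⟨2, rfl⟩
        simp [h0, h1, h2]
      simp [this, horth, Fin.val_inj]
  rw [hrhs]
  rw [Finset.sum_congr rfl (fun t ht => Finset.sum_congr rfl (fun σ _ => hin t (Finset.mem_filter.1 ht).2 σ))]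
  rw [Finset.sum_comm]
  have : ∀ σ : Equiv.Perm (Fin μ), ∑ t ∈ Finset.univ.filter
            (fun t : Fin μ × Fin μ × Fin μ =>
              t.1 ≠ t.2.1 ∧ t.1 ≠ t.2.2 ∧ t.2.1 ≠ t.2.2), D (σ t.1) (σ t.2.1) (σ t.2.2) =
       ∑ t ∈ Finset.univ.filter
            (fun t : Fin μ × Fin μ × Fin μ =>
              t.1 ≠ t.2.1 ∧ t.1 ≠ t.2.2 ∧ t.2.1 ≠ t.2.2), D t.1 t.2.1 t.2.2 := by
    intro σ
    refine Finset.sum_equiv (σ.prodCongr (σ.prodCongr σ)) ?_ ?_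
    · rintro ⟨a, b, c⟩; simp
    · rintro ⟨a, b, c⟩ -; simp
  simp only [this]
  simp [Fintype.card_perm]

theorem tmf_alt (k l N : ℕ) (hN : k ≤ N) : ∑ j ∈ Finset.range (N+1), (-1:ℝ)^j * (k.choose j) * (j.choose l) =
    if k = l then (-1)^l else 0 := by
  have h := fwdDiff_iter_choose_zero l k
  rw [fwdDiff_iter_eq_sum_shift] at h
  have h' := congrArg (fun z : ℤ => (-1:ℝ)^k * (z:ℝ)) h
  rw [← Finset.sum_subset (Finset.range_mono (Nat.add_le_add_right hN 1))]
  · push_cast at h'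
    rw [Finset.mul_sum] at h'
    trans
    · trans
      swap
      · exact h'
      · refine Finset.sum_congr rfl fun j hj => ?_
        have hj : j ≤ k := by simpa [Nat.lt_succ_iff] using hj
        have : (-1:ℝ)^k * (-1)^(k-j) = (-1)^j := by
          obtain ⟨r, rfl⟩ := Nat.exists_eq_add_of_le hj
          rw [Nat.add_sub_cancel_left, pow_add, mul_assoc, ← mul_pow]; simp
        rw [← this]
        simp [mul_assoc]
    · split_ifs with h
      · simp [h]
      · simp
  · intro j _ hj
    have : k < j := by simpa [Nat.lt_succ_iff] using hj
    simp [Nat.choose_eq_zero_of_lt this]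

open MeasureTheory in
theorem tmf_integrable (k l : ℕ) (β : ℝ) (hβ : 0 ≤ β) :
    IntegrableOn (fun q => Real.exp (-q) * q ^ β * laguerre k q * laguerre l q) (Set.Ioi 0) := by
  have h : ∀ j : ℕ, IntegrableOn (fun q : ℝ => Real.exp (-q) * q ^ β * q ^ j) (Set.Ioi 0) := by
    intro j
    refine (Real.GammaIntegral_convergent (s := β + j + 1) (by positivity)).congr_fun ?_ measurableSet_Ioi
    intro x hx
    have hx : 0 < x := hx
    simp only [add_sub_cancel_right]
    rw [Real.rpow_add hx, Real.rpow_natCast, mul_assoc]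
  have e : (fun q => Real.exp (-q) * q ^ β * laguerre k q * laguerre l q) = fun q =>
      ∑ i ∈ Finset.range (k+1), ∑ j ∈ Finset.range (l+1),
        ((-1) ^ i * (k.choose i : ℝ) / (i.factorial : ℝ)) * ((-1) ^ j * (l.choose j : ℝ) / (j.factorial : ℝ)) *
        (Real.exp (-q) * q ^ β * q ^ (i+j)) := by
    ext q
    rw [mul_assoc, laguerre, laguerre, Finset.sum_mul_sum, Finset.mul_sum]
    refine Finset.sum_congr rfl fun i _ => ?_
    rw [Finset.mul_sum]
    refine Finset.sum_congr rfl fun j _ => ?_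
    ring
  rw [e]
  exact integrable_finsetSum _ fun i _ => integrable_finsetSum _ fun j _ => (h _).const_mul _

open MeasureTheory in
theorem tmf_mom (j l : ℕ) : ∫ q in Set.Ioi (0:ℝ), Real.exp (-q) * q ^ j * laguerre l q =
    (-1)^l * (j.factorial * j.choose l : ℝ) := by
  have hG : ∀ j : ℕ, ∫ q in Set.Ioi (0:ℝ), Real.exp (-q) * q ^ j = (j.factorial : ℝ) := by
    intro j
    rw [← Real.Gamma_nat_eq_factorial, Real.Gamma_eq_integral (by positivity)]
    simp
  have hI : ∀ j : ℕ, IntegrableOn (fun q : ℝ => Real.exp (-q) * q ^ j) (Set.Ioi 0) := by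
    intro j
    have := Real.GammaIntegral_convergent (s := j + 1) (by positivity)
    simpa using this
  have e : (fun q => Real.exp (-q) * q ^ j * laguerre l q) = fun q =>
      ∑ i ∈ Finset.range (l+1),
        ((-1) ^ i * (l.choose i : ℝ) / (i.factorial : ℝ)) * (Real.exp (-q) * q ^ (i+j)) := by
    ext q
    rw [laguerre, Finset.mul_sum]
    refine Finset.sum_congr rfl fun i _ => ?_
    ring
  rw [e, integral_finsetSum _ fun i _ => (hI _).const_mul _]
  simp only [integral_const_mul, hG]
  have e2 : ∀ i, ((-1) ^ i * (l.choose i : ℝ) / (i.factorial : ℝ)) * ((i+j).factorial : ℝ) =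
      ∑ s ∈ Finset.range (j+1), (j.factorial * j.choose s : ℝ) * ((-1)^i * (l.choose i) * (i.choose s)) := by
    intro i
    have h1 : ((i+j).factorial : ℝ) = (i+j).choose j * i.factorial * j.factorial := by
      rw [← Nat.add_choose_mul_factorial_mul_factorial]; push_cast; rfl
    have h2 : ((i+j).choose j : ℝ) = ∑ s ∈ Finset.range (j+1), (i.choose s : ℝ) * (j.choose s) := by
      rw [Nat.add_choose_eq, Finset.Nat.sum_antidiagonal_eq_sum_range_succ_mk]
      push_cast
      refine Finset.sum_congr rfl fun s hs => ?_
      rw [Nat.choose_symm (by simpa [Nat.lt_succ_iff] using hs)]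
    rw [h1, h2]
    have : (i.factorial : ℝ) ≠ 0 := by positivity
    field_simp
    rw [Finset.mul_sum, Finset.sum_mul]
    refine Finset.sum_congr rfl fun s hs => ?_
    ring
  simp only [e2]
  rw [Finset.sum_comm]
  simp only [← Finset.mul_sum, tmf_alt l _ l le_rfl]
  simp only [mul_ite, mul_zero, Finset.sum_ite_eq]
  split_ifs with h
  · ring
  · have : j < l := by simpa [Nat.lt_succ_iff] using h
    simp [Nat.choose_eq_zero_of_lt this]

open MeasureTheory in
theorem tmf_orth (k l : ℕ) : Ikl k l 0 = if k = l then 1 else 0 := by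
  have hI : ∀ j : ℕ, IntegrableOn (fun q : ℝ => Real.exp (-q) * q ^ j * laguerre l q) (Set.Ioi 0) := by
    intro j
    have := tmf_integrable 0 l j (by positivity)
    simpa [laguerre] using this
  rw [Ikl]
  have e : (fun q => Real.exp (-q) * q ^ (0:ℝ) * laguerre k q * laguerre l q) = fun q =>
      ∑ i ∈ Finset.range (k+1),
        ((-1) ^ i * (k.choose i : ℝ) / (i.factorial : ℝ)) * (Real.exp (-q) * q ^ i * laguerre l q) := by
    ext q
    rw [laguerre.eq_def k q, Finset.mul_sum, Finset.sum_mul]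
    refine Finset.sum_congr rfl fun i _ => ?_
    rw [Real.rpow_zero]
    ring
  rw [e, integral_finsetSum _ fun i _ => (hI _).const_mul _]
  simp only [integral_const_mul, tmf_mom]
  have := tmf_alt k l k le_rfl
  have e3 : ∀ i, ((-1) ^ i * (k.choose i : ℝ) / (i.factorial : ℝ)) * ((-1)^l * (i.factorial * i.choose l : ℝ)) =
     (-1)^l * ((-1)^i * (k.choose i) * (i.choose l)) := by
    intro i
    have : (i.factorial : ℝ) ≠ 0 := by positivity
    field_simp
  simp only [e3, ← Finset.mul_sum, this]
  split_ifs
  · rw [← mul_pow]; simp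
  · simp

open MeasureTheory in
theorem tmf_mp (n : ℕ) : MeasurePreserving
    (fun p : (Fin n → ℝ) × ℝ => (Fin.last n).insertNth (α := fun _ => ℝ) (p.2 - ∑ i, p.1 i) p.1)
    (volume.prod volume) volume := by
  have h1 : MeasurePreserving (fun p : (Fin n → ℝ) × ℝ => (p.1, p.2 - ∑ i, p.1 i))
      (volume.prod volume) (volume.prod volume) := by
    refine (MeasurePreserving.id _).skew_product (g := fun (y : Fin n → ℝ) (s : ℝ) => s - ∑ i, y i) ?_ ?_
    · exact (by fun_prop : Measurable fun p : (Fin n → ℝ) × ℝ => p.2 - ∑ i, p.1 i)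
    · refine Filter.Eventually.of_forall fun y => ?_
      exact (measurePreserving_sub_right volume _).map_eq
  have h2 := (volume_preserving_piFinSuccAbove (fun _ : Fin (n+1) => ℝ) (Fin.last n)).symm
  have h3 := h2.comp (Measure.measurePreserving_swap.comp h1)
  exact h3

open MeasureTheory in
theorem tmf_polar (n d : ℕ) (H : (Fin (n+1) → ℝ) → ℝ)
    (hfi : Integrable (fun q => H q * Real.exp (-∑ i, q i)))
    (hom : ∀ s : ℝ, 0 < s → ∀ q, H (s • q) = s ^ d * H q)
    (supp : ∀ q, ∑ i, q i ≤ 0 → H q = 0) :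
    ∫ q, H q * Real.exp (-∑ i, q i) =
      ((n + d).factorial : ℝ) * ∫ x : Fin n → ℝ, H ((Fin.last n).insertNth (α := fun _ => ℝ) (1 - ∑ i, x i) x) := by
  have mp := tmf_mp n
  have hs : ∀ (y : Fin n → ℝ) (s : ℝ),
      ∑ i, (Fin.last n).insertNth (α := fun _ => ℝ) (s - ∑ i, y i) y i = s := by
    intro y s
    rw [Fin.sum_univ_castSucc]
    simp [Fin.insertNth_last']
  have hfi2 : Integrable (fun p : (Fin n → ℝ) × ℝ =>
      H ((Fin.last n).insertNth (α := fun _ => ℝ) (p.2 - ∑ i, p.1 i) p.1) * Real.exp (-p.2))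
      (volume.prod volume) := by
    have := mp.integrable_comp_of_integrable hfi
    simpa only [Function.comp_def, hs] using this
  have e1 : ∫ q, H q * Real.exp (-∑ i, q i) = ∫ p : (Fin n → ℝ) × ℝ,
      H ((Fin.last n).insertNth (α := fun _ => ℝ) (p.2 - ∑ i, p.1 i) p.1) * Real.exp (-p.2)
        ∂(volume.prod volume) := by
    rw [← mp.map_eq, integral_map mp.measurable.aemeasurable]
    · simp only [hs]
    · rw [mp.map_eq]; exact hfi.aestronglyMeasurable
  rw [e1, integral_prod_symm _ hfi2]
  have e2 : ∀ s : ℝ, ∫ y : Fin n → ℝ,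
      H ((Fin.last n).insertNth (α := fun _ => ℝ) (s - ∑ i, y i) y) * Real.exp (-s) =
      (Set.Ioi (0:ℝ)).indicator (fun s => (Real.exp (-s) * s ^ (n + d)) *
        ∫ x : Fin n → ℝ, H ((Fin.last n).insertNth (α := fun _ => ℝ) (1 - ∑ i, x i) x)) s := by
    intro s
    by_cases h : 0 < s
    · rw [Set.indicator_of_mem (by exact h), integral_mul_const]
      have := Measure.integral_comp_smul (volume : Measure (Fin n → ℝ))
        (fun y => H ((Fin.last n).insertNth (α := fun _ => ℝ) (s - ∑ i, y i) y)) s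
      have e3 : ∀ x : Fin n → ℝ, H ((Fin.last n).insertNth (α := fun _ => ℝ) (s - ∑ i, (s • x) i) (s • x))
          = s ^ d * H ((Fin.last n).insertNth (α := fun _ => ℝ) (1 - ∑ i, x i) x) := by
        intro x
        rw [← hom s h]
        congr 1
        ext i
        refine Fin.lastCases ?_ (fun j => ?_) i
        · simp [mul_sub, Finset.mul_sum]
        · simp [Fin.insertNth_last']
      simp only [e3, integral_const_mul] at this
      rw [Module.finrank_fin_fun, abs_of_pos (by positivity), smul_eq_mul,
        eq_inv_mul_iff_mul_eq₀ (by positivity)] at this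
      rw [← this, pow_add]; ring
    · rw [Set.indicator_of_notMem (by exact h)]
      have : ∀ y : Fin n → ℝ, H ((Fin.last n).insertNth (α := fun _ => ℝ) (s - ∑ i, y i) y) = 0 := by
        intro y; apply supp; rw [hs]; linarith
      simp only [this, zero_mul, integral_zero]
  simp only [e2]
  rw [integral_indicator measurableSet_Ioi, integral_mul_const]
  congr 1
  rw [← Real.Gamma_nat_eq_factorial, Real.Gamma_eq_integral (by positivity)]
  refine setIntegral_congr_fun measurableSet_Ioi fun x hx => ?_
  simp only [add_sub_cancel_right, Real.rpow_natCast]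

open Polynomial in
theorem tmf_vand (μ : ℕ) (q : Fin μ → ℝ) :
    ∏ a, ∏ b ∈ Finset.Ioi a, (q a - q b) ^ 2 =
      (∏ k ∈ Finset.range μ, ((k.factorial : ℝ)) ^ 2) *
        ∑ σ : Equiv.Perm (Fin μ), ∑ τ : Equiv.Perm (Fin μ),
        ((Equiv.Perm.sign σ : ℤ) : ℝ) * ((Equiv.Perm.sign τ : ℤ) : ℝ) *
          ∏ a, (laguerre (σ a) (q a) * laguerre (τ a) (q a)) := by
  let c : ℕ → ℝ := fun j => (-1)^j * (j.factorial : ℝ)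
  let p : Fin μ → ℝ[X] := fun j => ∑ k ∈ Finset.range ((j:ℕ)+1),
    C (c j * ((-1) ^ k * ((j:ℕ).choose k : ℝ) / (k.factorial : ℝ))) * X ^ k
  have hdeg : ∀ j, (p j).natDegree ≤ j := by
    intro j
    refine natDegree_sum_le_of_forall_le _ _ fun k hk => ?_
    refine (natDegree_C_mul_X_pow_le _ _).trans ?_
    simpa [Nat.lt_succ_iff] using hk
  have hco : ∀ j, (p j).coeff j = 1 := by
    intro j
    simp only [p, finsetSum_coeff, coeff_C_mul_X_pow, c]
    rw [Finset.sum_ite_eq, if_pos (by simp)]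
    have : ((j:ℕ).factorial : ℝ) ≠ 0 := by positivity
    have h2 : (-1:ℝ)^(j:ℕ) * (-1)^(j:ℕ) = 1 := by rw [← mul_pow]; simp
    simp only [Nat.choose_self, Nat.cast_one, mul_one]
    field_simp
    rw [pow_two, h2]
  have hmon : ∀ j, (p j).Monic := fun j => monic_of_natDegree_le_of_coeff_eq_one _ (hdeg j) (hco j)
  have hnd : ∀ j, (p j).natDegree = j := by
    intro j
    refine le_antisymm (hdeg j) (le_natDegree_of_ne_zero ?_)
    rw [hco]; exact one_ne_zero
  have hev : ∀ j x, (p j).eval x = c j * laguerre j x := by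
    intro j x
    simp only [p, eval_finsetSum, laguerre, Finset.mul_sum, eval_mul, eval_C, eval_pow, eval_X]
    refine Finset.sum_congr rfl fun k _ => ?_
    ring
  have h1 := Matrix.det_eval_matrixOfPolynomials_eq_det_vandermonde q p hnd hmon
  have h2 : ∏ a, ∏ b ∈ Finset.Ioi a, (q a - q b) ^ 2 = (Matrix.vandermonde q).det ^ 2 := by
    rw [Matrix.det_vandermonde, ← Finset.prod_pow]
    refine Finset.prod_congr rfl fun a _ => ?_
    rw [← Finset.prod_pow]
    refine Finset.prod_congr rfl fun b _ => ?_
    ring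
  have h3 : (Matrix.vandermonde q).det = (∏ j : Fin μ, c j) *
      (Matrix.of fun i j : Fin μ => laguerre j (q i)).det := by
    rw [h1, ← Matrix.det_mul_row]
    congr 1
    ext i j
    simp [hev]
  rw [h2, h3, mul_pow]
  congr 1
  · rw [← Finset.prod_pow, Finset.prod_range]
    refine Finset.prod_congr rfl fun a _ => ?_
    simp only [c]
    rw [mul_pow, ← pow_mul, mul_comm (a:ℕ), pow_mul]; simp
  · rw [← Matrix.det_transpose, Matrix.det_apply', pow_two, Finset.sum_mul_sum]
    refine Finset.sum_congr rfl fun σ _ => Finset.sum_congr rfl fun τ _ => ?_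
    simp only [Matrix.transpose_apply, Matrix.of_apply, Finset.prod_mul_distrib]
    ring

/-- exponent function -/
noncomputable def tmfBeta {μ : ℕ} (t : Fin μ × Fin μ × Fin μ) (a : Fin μ) : ℝ :=
  (if a = t.1 then 1 else 0) + (if a = t.2.1 then 1/2 else 0) + (if a = t.2.2 then 1/2 else 0)

/-- integrand -/
noncomputable def tmfF (μ : ℕ) (q : Fin μ → ℝ) : ℝ :=
  (∑ t ∈ Finset.univ.filter
            (fun t : Fin μ × Fin μ × Fin μ =>
              t.1 ≠ t.2.1 ∧ t.1 ≠ t.2.2 ∧ t.2.1 ≠ t.2.2),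
            q t.1 * Real.sqrt (q t.2.1 * q t.2.2)) *
          (∏ a, ∏ b ∈ Finset.Ioi a, (q a - q b) ^ 2)

open Classical in
/-- truncated integrand -/
noncomputable def tmfH (μ : ℕ) (q : Fin μ → ℝ) : ℝ := if ∀ i, 0 < q i then tmfF μ q else 0

/-- one-variable factor -/
noncomputable def tmfG (k l : ℕ) (β : ℝ) : ℝ → ℝ :=
  (Set.Ioi (0:ℝ)).indicator fun q => Real.exp (-q) * q ^ β * laguerre k q * laguerre l q

theorem tmf_expand (μ : ℕ) (q : Fin μ → ℝ) :
    tmfH μ q * Real.exp (-∑ i, q i) = (∏ k ∈ Finset.range μ, ((k.factorial : ℝ)) ^ 2) *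
      ∑ t ∈ Finset.univ.filter
            (fun t : Fin μ × Fin μ × Fin μ =>
              t.1 ≠ t.2.1 ∧ t.1 ≠ t.2.2 ∧ t.2.1 ≠ t.2.2),
        ∑ σ : Equiv.Perm (Fin μ), ∑ τ : Equiv.Perm (Fin μ),
        ((Equiv.Perm.sign σ : ℤ) : ℝ) * ((Equiv.Perm.sign τ : ℤ) : ℝ) *
          ∏ a, tmfG (σ a) (τ a) (tmfBeta t a) (q a) := by
  by_cases h : ∀ i, 0 < q i
  · rw [tmfH, if_pos h, tmfF, tmf_vand, mul_left_comm, mul_assoc]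
    congr 1
    rw [Finset.sum_mul, Finset.sum_mul]
    refine Finset.sum_congr rfl fun t _ => ?_
    rw [Finset.mul_sum, Finset.sum_mul]
    refine Finset.sum_congr rfl fun σ _ => ?_
    rw [Finset.mul_sum, Finset.sum_mul]
    refine Finset.sum_congr rfl fun τ _ => ?_
    have e1 : ∏ a, tmfG (σ a) (τ a) (tmfBeta t a) (q a) =
        ∏ a, (Real.exp (-q a) * q a ^ tmfBeta t a * (laguerre (σ a) (q a) * laguerre (τ a) (q a))) := by
      refine Finset.prod_congr rfl fun a _ => ?_
      rw [tmfG, Set.indicator_of_mem (by exact h a)]; ring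
    have e2 : ∏ a, q a ^ tmfBeta t a = q t.1 * Real.sqrt (q t.2.1 * q t.2.2) := by
      have : ∀ a, q a ^ tmfBeta t a = (if a = t.1 then q a else 1) *
          (if a = t.2.1 then Real.sqrt (q a) else 1) * (if a = t.2.2 then Real.sqrt (q a) else 1) := by
        intro a
        rw [tmfBeta, Real.rpow_add (h a), Real.rpow_add (h a), Real.sqrt_eq_rpow]
        split_ifs <;> simp
      simp only [this, Finset.prod_mul_distrib, Finset.prod_ite_eq', Finset.mem_univ, if_true]
      rw [Real.sqrt_mul (h _).le, mul_assoc]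
    simp only [e1, Finset.prod_mul_distrib]
    rw [e2, ← Real.exp_sum, Finset.sum_neg_distrib]
    ring
  · rw [tmfH, if_neg h, zero_mul]
    symm
    push Not at h
    obtain ⟨i, hi⟩ := h
    have : ∀ (t : Fin μ × Fin μ × Fin μ) (σ τ : Equiv.Perm (Fin μ)),
        ∏ a, tmfG (σ a) (τ a) (tmfBeta t a) (q a) = 0 := by
      intro t σ τ
      refine Finset.prod_eq_zero (Finset.mem_univ i) ?_
      rw [tmfG, Set.indicator_of_notMem (by simpa using hi)]
    simp [this]

theorem tmfBeta_nonneg {μ : ℕ} (t : Fin μ × Fin μ × Fin μ) (a : Fin μ) : 0 ≤ tmfBeta t a := by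
  unfold tmfBeta; positivity

open MeasureTheory in
theorem tmfG_integrable (k l : ℕ) (β : ℝ) (hβ : 0 ≤ β) : Integrable (tmfG k l β) :=
  (integrable_indicator_iff measurableSet_Ioi).2 (tmf_integrable k l β hβ)

open MeasureTheory in
theorem tmfG_integral (k l : ℕ) (β : ℝ) : ∫ x, tmfG k l β x = Ikl k l β :=
  integral_indicator measurableSet_Ioi

open MeasureTheory in
theorem tmf_prod_integrable (μ : ℕ) (t : Fin μ × Fin μ × Fin μ) (σ τ : Equiv.Perm (Fin μ)) :
    Integrable (fun q : Fin μ → ℝ => ∏ a, tmfG (σ a) (τ a) (tmfBeta t a) (q a)) :=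
  Integrable.fintype_prod (f := fun a => tmfG (σ a) (τ a) (tmfBeta t a))
    fun a => tmfG_integrable _ _ _ (tmfBeta_nonneg t a)

open MeasureTheory in
theorem tmfH_integrable (μ : ℕ) : Integrable (fun q => tmfH μ q * Real.exp (-∑ i, q i)) := by
  simp only [tmf_expand]
  refine Integrable.const_mul ?_ _
  exact integrable_finsetSum _ fun t _ => integrable_finsetSum _ fun σ _ =>
    integrable_finsetSum _ fun τ _ => (tmf_prod_integrable μ t σ τ).const_mul _

open MeasureTheory in
theorem tmfH_integral (μ : ℕ) : ∫ q, tmfH μ q * Real.exp (-∑ i, q i) = Qbar μ *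
    ∑ k ∈ Finset.range μ, ∑ l ∈ Finset.range μ, ∑ m ∈ Finset.range μ,
          Matrix.det !![Ikl k k 1, Ikl k l (1/2), Ikl k m (1/2);
                        Ikl l k 1, Ikl l l (1/2), Ikl l m (1/2);
                        Ikl m k 1, Ikl m l (1/2), Ikl m m (1/2)] := by
  have hsym : ∀ k l b, Ikl k l b = Ikl l k b := by
    intro k l b
    simp only [Ikl, mul_right_comm]
  have hc := tmf_comb μ Ikl tmf_orth hsym tmfBeta (fun t a => rfl)
  rw [Qbar, mul_comm (μ.factorial : ℝ), mul_assoc, ← hc]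
  simp only [tmf_expand]
  have hτ := fun (t : Fin μ × Fin μ × Fin μ) (σ τ : Equiv.Perm (Fin μ)) =>
    (tmf_prod_integrable μ t σ τ).const_mul (((Equiv.Perm.sign σ : ℤ) : ℝ) * ((Equiv.Perm.sign τ : ℤ) : ℝ))
  have hσ := fun (t : Fin μ × Fin μ × Fin μ) (σ : Equiv.Perm (Fin μ)) =>
    integrable_finsetSum Finset.univ fun τ _ => hτ t σ τ
  have ht := fun (t : Fin μ × Fin μ × Fin μ) =>
    integrable_finsetSum Finset.univ fun σ _ => hσ t σ
  rw [integral_const_mul, integral_finsetSum _ fun t _ => ht t]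
  congr 1
  refine Finset.sum_congr rfl fun t _ => ?_
  rw [integral_finsetSum _ fun σ _ => hσ t σ]
  refine Finset.sum_congr rfl fun σ _ => ?_
  rw [integral_finsetSum _ fun τ _ => hτ t σ τ]
  refine Finset.sum_congr rfl fun τ _ => ?_
  rw [integral_const_mul, integral_fintype_prod_volume_eq_prod (fun a => tmfG (σ a) (τ a) (tmfBeta t a))]
  simp only [tmfG_integral]

theorem tmfH_hom (n : ℕ) (s : ℝ) (hs : 0 < s) (q : Fin (n+1) → ℝ) :
    tmfH (n+1) (s • q) = s ^ (2 + n * (n+1)) * tmfH (n+1) q := by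
  have h : (∀ i, 0 < (s • q) i) ↔ ∀ i, 0 < q i := by
    simp [hs]
  simp only [tmfH, h]
  split_ifs
  · simp only [tmfF, Pi.smul_apply, smul_eq_mul, ← mul_sub, mul_pow, Finset.prod_mul_distrib]
    have e1 : ∏ a : Fin (n+1), ∏ b ∈ Finset.Ioi a, s ^ 2 = s ^ (n * (n+1)) := by
      simp only [Finset.prod_const, Fin.card_Ioi, ← pow_mul]
      rw [Finset.prod_pow_eq_pow_sum, ← Finset.mul_sum]
      congr 1
      have := Finset.sum_range_id_mul_two (n+1)
      rw [← Finset.sum_range_reflect, Finset.sum_range] at this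
      simp only [add_tsub_cancel_right] at this ⊢
      rw [mul_comm, this, mul_comm]
    have e2 : ∀ a b c : ℝ, s * a * Real.sqrt (s * b * (s * c)) = s^2 * (a * Real.sqrt (b * c)) := by
      intro a b c
      rw [show s * b * (s * c) = s^2 * (b * c) by ring, Real.sqrt_mul (by positivity), Real.sqrt_sq hs.le]
      ring
    simp only [e1, e2, ← Finset.mul_sum, pow_add]
    ring
  · simp

theorem tmfH_supp (n : ℕ) (q : Fin (n+1) → ℝ) (hq : ∑ i, q i ≤ 0) : tmfH (n+1) q = 0 := by
  rw [tmfH, if_neg]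
  intro h
  have := Finset.sum_pos (fun i _ => h i) (Finset.univ_nonempty (α := Fin (n+1)))
  linarith

open MeasureTheory in
theorem third_moment_formula (μ : ℕ) (hμ : 1 ≤ μ) :
    (Real.Gamma ((μ : ℝ) ^ 2) / Qbar μ) *
      ∫ x in Dset μ,
        (∑ t ∈ Finset.univ.filter
            (fun t : Fin μ × Fin μ × Fin μ =>
              t.1 ≠ t.2.1 ∧ t.1 ≠ t.2.2 ∧ t.2.1 ≠ t.2.2),
            pExt μ x t.1 * Real.sqrt (pExt μ x t.2.1 * pExt μ x t.2.2)) *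
          (∏ a, ∏ b ∈ Finset.Ioi a, (pExt μ x a - pExt μ x b) ^ 2)
      = (1 / ((μ : ℝ) ^ 2 * ((μ : ℝ) ^ 2 + 1))) *
        ∑ k ∈ Finset.range μ, ∑ l ∈ Finset.range μ, ∑ m ∈ Finset.range μ,
          Matrix.det !![Ikl k k 1, Ikl k l (1/2), Ikl k m (1/2);
                        Ikl l k 1, Ikl l l (1/2), Ikl l m (1/2);
                        Ikl m k 1, Ikl m l (1/2), Ikl m m (1/2)] := by
  obtain ⟨n, rfl⟩ : ∃ n, μ = n + 1 := ⟨μ - 1, by omega⟩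
  have hp := tmf_polar n (2 + n * (n+1)) (tmfH (n+1)) (tmfH_integrable (n+1)) (tmfH_hom n) (tmfH_supp n)
  rw [tmfH_integral] at hp
  have hext : ∀ x : Fin n → ℝ,
      (Fin.last n).insertNth (α := fun _ => ℝ) (1 - ∑ i, x i) x = pExt (n+1) x := by
    intro x
    ext i
    refine Fin.lastCases ?_ (fun j => ?_) i
    · simp [pExt]
    · simp [pExt, Fin.insertNth_last']
  have hmeas : MeasurableSet (Dset (n+1)) := by
    have : IsOpen (Dset (n+1)) := by
      rw [Dset, Set.ofPred_and]
      refine IsOpen.inter ?_ ?_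
      · rw [Set.ofPred_forall]
        exact isOpen_iInter_of_finite fun i => isOpen_lt continuous_const (continuous_apply i)
      · exact isOpen_lt (by fun_prop) continuous_const
    exact this.measurableSet
  have hD : ∫ x : Fin n → ℝ, tmfH (n+1) ((Fin.last n).insertNth (α := fun _ => ℝ) (1 - ∑ i, x i) x)
      = ∫ x in Dset (n+1), tmfF (n+1) (pExt (n+1) x) := by
    rw [← integral_indicator hmeas]
    refine integral_congr_ae (Filter.Eventually.of_forall fun x => ?_)
    have hiff : (∀ i, 0 < pExt (n+1) x i) ↔ x ∈ Dset (n+1) := by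
      rw [← hext, Fin.forall_fin_succ']
      simp [Dset, Fin.insertNth_last']
    simp only [hext]
    by_cases hx : x ∈ Dset (n+1)
    · rw [Set.indicator_of_mem hx, tmfH, if_pos (hiff.2 hx)]
    · rw [Set.indicator_of_notMem hx, tmfH, if_neg (fun h => hx (hiff.1 h))]
  rw [hD] at hp
  change _ * ∫ x in Dset (n+1), tmfF (n+1) (pExt (n+1) x) = _
  have hQ : Qbar (n+1) ≠ 0 := by
    unfold Qbar; positivity
  have hG : ((n + (2 + n * (n+1))).factorial : ℝ) =
      ((n+1 : ℕ):ℝ)^2 * (((n+1 : ℕ):ℝ)^2 + 1) * Real.Gamma (((n+1 : ℕ):ℝ)^2) := by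
    rw [show n + (2 + n * (n+1)) = (n+1)^2 + 1 by ring, ← Real.Gamma_nat_eq_factorial]
    push_cast
    rw [Real.Gamma_add_one (by positivity), Real.Gamma_add_one (by positivity)]
    ring
  rw [hG] at hp
  have h0 : ((n+1 : ℕ):ℝ)^2 * (((n+1 : ℕ):ℝ)^2 + 1) ≠ 0 := by positivity
  rw [one_div, eq_inv_mul_iff_mul_eq₀ h0, div_mul_eq_mul_div, ← mul_div_assoc, div_eq_iff hQ, mul_comm _ (Qbar _), hp]
  ring
end
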